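/- Let R₁, R₂, R₃ be independent standard Gaussian vectors in ℝⁿ, fix 0 < α < 2 and set ℓ_α = E[|Z|^α] for standard normal Z. Define Y = E[(|⟨R₁,R₂⟩/√n|^α − ℓ_α)(|⟨R₂,R₃⟩/√n|^α − ℓ_α) | R₁, R₃]. Then for every positive integer k there is a constant M_k (independent of n) with E[(nY)^k] ≤ M_k for all n. -/

import Mathlib

open MeasureTheory ProbabilityTheory Finset

theorem cosh_mul_sub_one_le {ρ : ℝ} (hρ : |ρ| ≤ 1) (x : ℝ) :
    Real.cosh (ρ * x) - 1 ≤ ρ ^ 2 * (Real.cosh x - 1) := by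
  have hg : HasSum (fun n : ℕ => ρ ^ 2 * (x ^ (2 * n) / ((2 * n).factorial : ℝ)) +
      if n = 0 then 1 - ρ ^ 2 else 0) (ρ ^ 2 * Real.cosh x + (1 - ρ ^ 2)) :=
    ((Real.hasSum_cosh x).mul_left _).add (hasSum_ite_eq 0 _)
  have hle := hasSum_le (fun n => ?_) (Real.hasSum_cosh (ρ * x)) hg
  · linarith
  · have hρ2 : ρ ^ 2 ≤ 1 := (sq_le_one_iff_abs_le_one ρ).2 hρ
    rcases n with _ | n
    · simp
    · simp only [Nat.add_eq_zero_iff, one_ne_zero, and_false, if_false, add_zero]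
      rw [← mul_div_assoc, mul_pow]
      have h1 : ρ ^ (2 * (n + 1)) ≤ ρ ^ 2 := by
        rw [pow_mul]
        exact pow_le_of_le_one (sq_nonneg ρ) hρ2 (by omega)
      have h2 : 0 ≤ x ^ (2 * (n + 1)) := by rw [pow_mul]; positivity
      gcongr

/-- The standard Gaussian measure on `ℝⁿ`. -/
noncomputable abbrev stdGaussianPi (n : ℕ) : Measure (Fin n → ℝ) :=
  Measure.pi fun _ : Fin n => gaussianReal 0 1

section Law

variable {n : ℕ}

theorem integral_cexp_dot (c : Fin n → ℝ) :
    ∫ r, Complex.exp ((∑ i, c i * r i : ℝ) * Complex.I) ∂stdGaussianPi n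
      = Complex.exp (-(∑ i, c i ^ 2 : ℝ) / 2) := by
  have h : ∀ r : Fin n → ℝ, Complex.exp ((∑ i, c i * r i : ℝ) * Complex.I)
      = ∏ i, Complex.exp ((c i : ℂ) * (r i : ℂ) * Complex.I) := fun r => by
    rw [← Complex.exp_sum]
    push_cast
    rw [Finset.sum_mul]
  simp_rw [h]
  rw [integral_fintype_prod_eq_prod (fun i (x : ℝ) => Complex.exp ((c i : ℂ) * (x : ℂ) * Complex.I))]
  simp_rw [← charFun_apply_real, charFun_gaussianReal]
  rw [← Complex.exp_sum]
  congr 1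
  push_cast
  rw [neg_div, Finset.sum_div, ← Finset.sum_neg_distrib]
  exact Finset.sum_congr rfl fun i _ => by ring

theorem integral_cos_dot (c : Fin n → ℝ) :
    ∫ r, Real.cos (∑ i, c i * r i) ∂stdGaussianPi n = Real.exp (-(∑ i, c i ^ 2) / 2) := by
  have h := congrArg Complex.re (integral_cexp_dot c)
  rw [← RCLike.re_eq_complex_re, ← integral_re] at h
  · simp only [RCLike.re_eq_complex_re, Complex.exp_ofReal_mul_I_re] at h
    rw [h, ← Complex.exp_ofReal_re]
    push_cast
    rfl
  · refine Integrable.of_bound (C := 1)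
      (by fun_prop : Continuous _).aestronglyMeasurable (ae_of_all _ fun r => ?_)
    rw [Complex.norm_exp_ofReal_mul_I]

theorem map_dot_stdGaussianPi (c : Fin n → ℝ) :
    (stdGaussianPi n).map (fun r => ∑ i, c i * r i)
      = gaussianReal 0 (∑ i, c i ^ 2).toNNReal := by
  have hm : Measurable fun r : Fin n → ℝ => ∑ i, c i * r i := by fun_prop
  have := Measure.isProbabilityMeasure_map (μ := stdGaussianPi n) hm.aemeasurable
  refine Measure.ext_of_charFun (funext fun t => ?_)
  rw [charFun_apply_real, integral_map hm.aemeasurable (by fun_prop : Continuous _).aestronglyMeasurable,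
    charFun_gaussianReal]
  have h := integral_cexp_dot (fun i => t * c i)
  have e : ∀ r : Fin n → ℝ, ∑ i, t * c i * r i = t * ∑ i, c i * r i := fun r => by
    rw [Finset.mul_sum]; simp_rw [mul_assoc]
  have e2 : ∑ i, (t * c i) ^ 2 = t ^ 2 * ∑ i, c i ^ 2 := by
    rw [Finset.mul_sum]; simp_rw [mul_pow]
  simp_rw [e, e2] at h
  simp only [Complex.ofReal_mul] at h
  rw [h]
  congr 1
  have : ((∑ i, c i ^ 2).toNNReal : ℝ) = ∑ i, c i ^ 2 :=
    Real.coe_toNNReal _ (by positivity)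
  rw [this]
  push_cast
  ring

theorem integral_one_sub_cos_mul (a b : Fin n → ℝ) (t s : ℝ) :
    ∫ r, (1 - Real.cos (t * ∑ i, a i * r i)) * (1 - Real.cos (s * ∑ i, b i * r i))
        ∂stdGaussianPi n
      = (1 - Real.exp (-(t ^ 2 * ∑ i, a i ^ 2) / 2)) * (1 - Real.exp (-(s ^ 2 * ∑ i, b i ^ 2) / 2))
        + Real.exp (-(t ^ 2 * ∑ i, a i ^ 2 + s ^ 2 * ∑ i, b i ^ 2) / 2)
          * (Real.cosh (t * s * ∑ i, a i * b i) - 1) := by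
  have hint : ∀ c : Fin n → ℝ, Integrable (fun r => Real.cos (∑ i, c i * r i))
      (stdGaussianPi n) := fun c =>
    Integrable.of_bound (C := 1) (by fun_prop : Continuous _).aestronglyMeasurable
      (ae_of_all _ fun r => by simpa using Real.abs_cos_le_one _)
  have e : ∀ r : Fin n → ℝ,
      (1 - Real.cos (t * ∑ i, a i * r i)) * (1 - Real.cos (s * ∑ i, b i * r i))
      = 1 - Real.cos (∑ i, (t * a i) * r i) - Real.cos (∑ i, (s * b i) * r i)
        + (Real.cos (∑ i, (t * a i + s * b i) * r i)
          + Real.cos (∑ i, (t * a i - s * b i) * r i)) / 2 := fun r => by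
    have h1 : ∑ i, (t * a i) * r i = t * ∑ i, a i * r i := by
      rw [Finset.mul_sum]; simp_rw [mul_assoc]
    have h2 : ∑ i, (s * b i) * r i = s * ∑ i, b i * r i := by
      rw [Finset.mul_sum]; simp_rw [mul_assoc]
    simp_rw [add_mul, sub_mul, Finset.sum_add_distrib, Finset.sum_sub_distrib]
    rw [h1, h2, Real.cos_add, Real.cos_sub]
    ring
  simp_rw [e]
  have i1 : Integrable (fun r => 1 - Real.cos (∑ i, (t * a i) * r i)) (stdGaussianPi n) :=
    (integrable_const _).sub (hint _)
  have i2 : Integrable (fun r => 1 - Real.cos (∑ i, (t * a i) * r i)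
      - Real.cos (∑ i, (s * b i) * r i)) (stdGaussianPi n) := i1.sub (hint _)
  have i3 : Integrable (fun r => (Real.cos (∑ i, (t * a i + s * b i) * r i)
      + Real.cos (∑ i, (t * a i - s * b i) * r i)) / 2) (stdGaussianPi n) :=
    ((hint _).add (hint _)).div_const 2
  rw [integral_add i2 i3, integral_sub i1 (hint _), integral_sub (integrable_const _) (hint _),
    integral_div, integral_add (hint _) (hint _)]
  simp_rw [integral_cos_dot]
  have h1 : ∑ i, (t * a i) ^ 2 = t ^ 2 * ∑ i, a i ^ 2 := by
    rw [Finset.mul_sum]; simp_rw [mul_pow]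
  have h2 : ∑ i, (s * b i) ^ 2 = s ^ 2 * ∑ i, b i ^ 2 := by
    rw [Finset.mul_sum]; simp_rw [mul_pow]
  have h3 : ∑ i, (t * a i + s * b i) ^ 2
      = t ^ 2 * ∑ i, a i ^ 2 + s ^ 2 * ∑ i, b i ^ 2 + 2 * (t * s * ∑ i, a i * b i) := by
    simp_rw [Finset.mul_sum]
    rw [← Finset.sum_add_distrib, ← Finset.sum_add_distrib]
    exact Finset.sum_congr rfl fun i _ => by ring
  have h4 : ∑ i, (t * a i - s * b i) ^ 2
      = t ^ 2 * ∑ i, a i ^ 2 + s ^ 2 * ∑ i, b i ^ 2 - 2 * (t * s * ∑ i, a i * b i) := by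
    simp_rw [Finset.mul_sum]
    rw [← Finset.sum_add_distrib, ← Finset.sum_sub_distrib]
    exact Finset.sum_congr rfl fun i _ => by ring
  rw [h1, h2, h3, h4, Real.cosh_eq]
  set A := t ^ 2 * ∑ i, a i ^ 2
  set B := s ^ 2 * ∑ i, b i ^ 2
  set D := t * s * ∑ i, a i * b i
  have e1 : Real.exp (-(A + B + 2 * D) / 2) = Real.exp (-(A + B) / 2) * Real.exp (-D) := by
    rw [← Real.exp_add]; ring_nf
  have e2 : Real.exp (-(A + B - 2 * D) / 2) = Real.exp (-(A + B) / 2) * Real.exp D := by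
    rw [← Real.exp_add]; ring_nf
  have e3 : Real.exp (-(A + B) / 2) = Real.exp (-A / 2) * Real.exp (-B / 2) := by
    rw [← Real.exp_add]; ring_nf
  rw [e1, e2, e3]
  simp
  ring

end Law

/-- The Lévy weight `|t|^(-1-α)`, for which `∫ (1 - cos (t x)) = const * |x|^α`. -/
noncomputable def levyMeasure (α : ℝ) : Measure ℝ :=
  volume.withDensity fun t => ENNReal.ofReal (|t| ^ (-1 - α))

/-- The normalizing constant `∫ (1 - cos t) |t|^(-1-α) dt`. -/
noncomputable def levyConst (α : ℝ) : ENNReal :=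
  ∫⁻ t, ENNReal.ofReal (1 - Real.cos t) ∂levyMeasure α

instance (α : ℝ) : SFinite (levyMeasure α) := by unfold levyMeasure; infer_instance

section Levy

variable {α : ℝ}

theorem lintegral_levyMeasure {f : ℝ → ENNReal} (hf : Measurable f) :
    ∫⁻ t, f t ∂levyMeasure α = ∫⁻ t, ENNReal.ofReal (|t| ^ (-1 - α)) * f t := by
  rw [levyMeasure, lintegral_withDensity_eq_lintegral_mul _ (by fun_prop) hf]
  rfl

theorem levyConst_ne_zero : levyConst α ≠ 0 := by
  rw [levyConst, lintegral_levyMeasure (by fun_prop)]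
  have hm : Measurable fun t : ℝ =>
    ENNReal.ofReal (|t| ^ (-1 - α)) * ENNReal.ofReal (1 - Real.cos t) := by fun_prop
  intro h
  rw [lintegral_eq_zero_iff hm] at h
  have h0 : volume (Set.Ioo (0 : ℝ) 1) = 0 := by
    refine measure_mono_null (fun t ht => ?_) h
    have hc : Real.cos t < 1 := by
      have := Real.cos_lt_cos_of_nonneg_of_le_pi_div_two le_rfl
        (by linarith [ht.2, Real.pi_gt_three] : t ≤ Real.pi / 2) ht.1
      simpa using this
    have hp : 0 < |t| ^ (-1 - α) := Real.rpow_pos_of_pos (abs_pos.2 ht.1.ne') _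
    simp only [Set.mem_compl_iff, Set.mem_ofPred_eq, Pi.zero_apply, mul_eq_zero,
      ENNReal.ofReal_eq_zero, not_or, not_le]
    exact ⟨hp, by linarith⟩
  simp at h0

theorem levyConst_ne_top (h0 : 0 < α) (h2 : α < 2) : levyConst α ≠ ⊤ := by
  rw [levyConst, lintegral_levyMeasure (by fun_prop)]
  set g : ℝ → ENNReal := fun t =>
    ENNReal.ofReal (|t| ^ (-1 - α)) * ENNReal.ofReal (1 - Real.cos t)
  have hIoi : ∫⁻ t in Set.Ioi (0 : ℝ), g t < ⊤ := by
    have hsplit : Set.Ioi (0 : ℝ) = Set.Ioo 0 1 ∪ Set.Ici 1 := by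
      rw [Set.Ioo_union_Ici_eq_Ioi one_pos]
    rw [hsplit]
    refine (lintegral_union_le _ _ _).trans_lt (ENNReal.add_lt_top.2 ⟨?_, ?_⟩)
    · have hi : IntegrableOn (fun t : ℝ => t ^ (1 - α)) (Set.Ioo 0 1) :=
        (intervalIntegral.integrableOn_Ioo_rpow_iff one_pos).2 (by linarith)
      refine (setLIntegral_mono' measurableSet_Ioo fun t ht => ?_).trans_lt
        (Integrable.lintegral_lt_top hi)
      simp only [g]
      rw [← ENNReal.ofReal_mul (by positivity)]
      refine ENNReal.ofReal_le_ofReal ?_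
      rw [abs_of_pos ht.1]
      have e : t ^ (1 - α) = t ^ (-1 - α) * t ^ 2 := by
        rw [← Real.rpow_natCast, ← Real.rpow_add ht.1]
        push_cast
        ring_nf
      rw [e]
      have := ht.1
      gcongr
      nlinarith [Real.one_sub_sq_div_two_le_cos (x := t)]
    · have hi : IntegrableOn (fun t : ℝ => 2 * t ^ (-1 - α)) (Set.Ici 1) :=
        ((integrableOn_Ici_iff_integrableOn_Ioi).2
          (integrableOn_Ioi_rpow_of_lt (by linarith) one_pos)).const_mul 2
      refine (setLIntegral_mono' measurableSet_Ici fun t ht => ?_).trans_lt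
        (Integrable.lintegral_lt_top hi)
      have ht' : (0 : ℝ) < t := lt_of_lt_of_le one_pos ht
      simp only [g]
      rw [← ENNReal.ofReal_mul (by positivity)]
      refine ENNReal.ofReal_le_ofReal ?_
      rw [abs_of_pos ht', mul_comm]
      gcongr
      linarith [Real.neg_one_le_cos t]
  have hneg : ∫⁻ t in Set.Iio (0 : ℝ), g t = ∫⁻ t in Set.Ioi (0 : ℝ), g t := by
    have := (Measure.measurePreserving_neg (volume : Measure ℝ)).setLIntegral_comp_preimage_emb
      (MeasurableEquiv.neg ℝ).measurableEmbedding g (Set.Ioi 0)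
    rw [← this]
    simp [g]
  rw [← lintegral_add_compl g (measurableSet_Ioi (a := (0 : ℝ))), Set.compl_Ioi,
    setLIntegral_congr Iio_ae_eq_Iic.symm, hneg]
  exact (ENNReal.add_lt_top.2 ⟨hIoi, hIoi⟩).ne

theorem lintegral_one_sub_cos_levy (h0 : 0 < α) (x : ℝ) :
    ∫⁻ t, ENNReal.ofReal (1 - Real.cos (t * x)) ∂levyMeasure α
      = levyConst α * ENNReal.ofReal (|x| ^ α) := by
  rcases eq_or_ne x 0 with rfl | hx
  · simp [Real.zero_rpow h0.ne']
  set g : ℝ → ENNReal := fun t =>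
    ENNReal.ofReal (|t| ^ (-1 - α)) * ENNReal.ofReal (1 - Real.cos t)
  have hg : Measurable g := by fun_prop
  rw [levyConst, lintegral_levyMeasure (by fun_prop), lintegral_levyMeasure (by fun_prop)]
  have hx' : 0 < |x| := abs_pos.2 hx
  have e : ∀ t, ENNReal.ofReal (|t| ^ (-1 - α)) * ENNReal.ofReal (1 - Real.cos (t * x))
      = ENNReal.ofReal (|x| ^ (1 + α)) * g (x * t) := fun t => by
    simp only [g]
    rw [← mul_assoc, ← ENNReal.ofReal_mul (p := |x| ^ (1 + α)) (by positivity), abs_mul,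
      Real.mul_rpow (abs_nonneg _) (abs_nonneg _), ← mul_assoc, ← Real.rpow_add hx', mul_comm x t]
    norm_num
  simp_rw [e]
  rw [lintegral_const_mul _ (by fun_prop), ← lintegral_map (g := fun t => x * t) hg (by fun_prop),
    Real.map_volume_mul_left hx, lintegral_smul_measure, smul_eq_mul, ← mul_assoc,
    ← ENNReal.ofReal_mul (by positivity), mul_comm]
  congr 2
  rw [abs_inv, Real.rpow_add hx', Real.rpow_one]
  field_simp

end Levy

section Moments

variable {n : ℕ} {α : ℝ}

theorem lintegral_dot (a : Fin n → ℝ) {f : ℝ → ENNReal} (hf : Measurable f) :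
    ∫⁻ r, f (∑ i, a i * r i) ∂stdGaussianPi n
      = ∫⁻ z, f (Real.sqrt (∑ i, a i ^ 2) * z) ∂gaussianReal 0 1 := by
  have hV : 0 ≤ ∑ i, a i ^ 2 := by positivity
  rw [← lintegral_map (g := fun r : Fin n → ℝ => ∑ i, a i * r i) hf (by fun_prop),
    map_dot_stdGaussianPi,
    ← lintegral_map (g := fun z => Real.sqrt (∑ i, a i ^ 2) * z) hf (by fun_prop),
    gaussianReal_map_const_mul]
  congr 2
  · simp
  · ext
    simp [Real.sq_sqrt hV, Real.coe_toNNReal _ hV]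

theorem integrable_abs_rpow_gaussianReal {p : ℝ} (hp : 0 < p) :
    Integrable (fun z : ℝ => |z| ^ p) (gaussianReal 0 1) := by
  have h := (memLp_id_gaussianReal (μ := 0) (v := 1) p.toNNReal).integrable_norm_rpow
    (by simpa using hp) (by simp)
  simpa [hp.le] using h

theorem lintegral_abs_rpow_gaussianReal {p : ℝ} (hp : 0 < p) :
    ∫⁻ z : ℝ, ENNReal.ofReal (|z| ^ p) ∂gaussianReal 0 1
      = ENNReal.ofReal (∫ z : ℝ, |z| ^ p ∂gaussianReal 0 1) :=
  (ofReal_integral_eq_lintegral_ofReal (integrable_abs_rpow_gaussianReal hp)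
    (ae_of_all _ fun z => by positivity)).symm

theorem lintegral_abs_dot_rpow (a : Fin n → ℝ) {p : ℝ} (hp : 0 < p) :
    ∫⁻ r, ENNReal.ofReal (|∑ i, a i * r i| ^ p) ∂stdGaussianPi n
      = ENNReal.ofReal (Real.sqrt (∑ i, a i ^ 2) ^ p * ∫ z : ℝ, |z| ^ p ∂gaussianReal 0 1) := by
  rw [lintegral_dot a (f := fun x => ENNReal.ofReal (|x| ^ p)) (by fun_prop)]
  simp_rw [abs_mul, abs_of_nonneg (Real.sqrt_nonneg _),
    Real.mul_rpow (Real.sqrt_nonneg _) (abs_nonneg _),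
    ENNReal.ofReal_mul (Real.rpow_nonneg (Real.sqrt_nonneg _) p)]
  rw [lintegral_const_mul _ (by fun_prop), lintegral_abs_rpow_gaussianReal hp]

/-- The excess of the mixed moment over the product of moments, in the Lévy representation. -/
noncomputable def levyCov (α v w c : ℝ) : ENNReal :=
  ∫⁻ t, ∫⁻ s, ENNReal.ofReal (Real.exp (-(t ^ 2 * v + s ^ 2 * w) / 2)
    * (Real.cosh (t * s * c) - 1)) ∂levyMeasure α ∂levyMeasure α

theorem levyCov_mul_le {ρ : ℝ} (hρ : |ρ| ≤ 1) (v w d : ℝ) :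
    levyCov α v w (ρ * d) ≤ ENNReal.ofReal (ρ ^ 2) * levyCov α v w d := by
  have hm : Measurable fun p : ℝ × ℝ =>
      ENNReal.ofReal (Real.exp (-(p.1 ^ 2 * v + p.2 ^ 2 * w) / 2)
        * (Real.cosh (p.1 * p.2 * d) - 1)) := by fun_prop
  unfold levyCov
  rw [← lintegral_const_mul _ hm.lintegral_prod_right']
  refine lintegral_mono fun t => ?_
  rw [← lintegral_const_mul _ (by fun_prop)]
  refine lintegral_mono fun s => ?_
  rw [← ENNReal.ofReal_mul (sq_nonneg ρ)]
  refine ENNReal.ofReal_le_ofReal ?_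
  have := cosh_mul_sub_one_le hρ (t * s * d)
  rw [show t * s * (ρ * d) = ρ * (t * s * d) by ring, mul_left_comm (ρ ^ 2)]
  gcongr

theorem levyCov_zero (v w : ℝ) : levyCov α v w 0 = 0 := by
  simp [levyCov]

theorem levyConst_mul_lintegral_abs_dot (h0 : 0 < α) (a : Fin n → ℝ) :
    levyConst α * ∫⁻ r, ENNReal.ofReal (|∑ i, a i * r i| ^ α) ∂stdGaussianPi n
      = ∫⁻ t, ENNReal.ofReal (1 - Real.exp (-(t ^ 2 * ∑ i, a i ^ 2) / 2)) ∂levyMeasure α := by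
  rw [← lintegral_const_mul _ (by fun_prop)]
  simp_rw [← lintegral_one_sub_cos_levy h0]
  rw [lintegral_lintegral_swap (by fun_prop)]
  refine lintegral_congr fun t => ?_
  have hi : Integrable (fun r => Real.cos (t * ∑ i, a i * r i)) (stdGaussianPi n) :=
    Integrable.of_bound (C := 1) (by fun_prop : Continuous _).aestronglyMeasurable
      (ae_of_all _ fun r => by simpa using Real.abs_cos_le_one _)
  have hi' : Integrable (fun r => 1 - Real.cos (t * ∑ i, a i * r i)) (stdGaussianPi n) :=
    (integrable_const _).sub hi
  rw [← ofReal_integral_eq_lintegral_ofReal hi'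
    (ae_of_all _ fun r => by simpa using Real.cos_le_one _),
    integral_sub (integrable_const _) hi]
  have h := integral_cos_dot (fun i => t * a i)
  simp_rw [mul_assoc, ← Finset.mul_sum, mul_pow, ← Finset.mul_sum] at h
  rw [h]
  simp

theorem levyConst_sq_mul_lintegral (h0 : 0 < α) (a b : Fin n → ℝ) :
    levyConst α * levyConst α * ∫⁻ r, ENNReal.ofReal (|∑ i, a i * r i| ^ α)
        * ENNReal.ofReal (|∑ i, b i * r i| ^ α) ∂stdGaussianPi n
      = levyConst α * levyConst α
          * ((∫⁻ r, ENNReal.ofReal (|∑ i, a i * r i| ^ α) ∂stdGaussianPi n)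
            * ∫⁻ r, ENNReal.ofReal (|∑ i, b i * r i| ^ α) ∂stdGaussianPi n)
        + levyCov α (∑ i, a i ^ 2) (∑ i, b i ^ 2) (∑ i, a i * b i) := by
  rw [mul_mul_mul_comm, levyConst_mul_lintegral_abs_dot h0, levyConst_mul_lintegral_abs_dot h0,
    ← lintegral_const_mul _ (by fun_prop)]
  simp_rw [mul_mul_mul_comm (levyConst α) (levyConst α), ← lintegral_one_sub_cos_levy h0]
  have hstep : ∀ r : Fin n → ℝ,
      (∫⁻ t, ENNReal.ofReal (1 - Real.cos (t * ∑ i, a i * r i)) ∂levyMeasure α)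
        * ∫⁻ s, ENNReal.ofReal (1 - Real.cos (s * ∑ i, b i * r i)) ∂levyMeasure α
      = ∫⁻ p : ℝ × ℝ, ENNReal.ofReal ((1 - Real.cos (p.1 * ∑ i, a i * r i))
          * (1 - Real.cos (p.2 * ∑ i, b i * r i))) ∂(levyMeasure α).prod (levyMeasure α) :=
    fun r => by
      rw [← lintegral_prod_mul (by fun_prop) (by fun_prop)]
      exact lintegral_congr fun p =>
        (ENNReal.ofReal_mul (by linarith [Real.cos_le_one (p.1 * ∑ i, a i * r i)])).symm
  simp_rw [hstep]
  rw [lintegral_lintegral_swap (by fun_prop)]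
  have hnn : ∀ x : ℝ, 0 ≤ 1 - Real.cos x := fun x => by linarith [Real.cos_le_one x]
  have hexp : ∀ x v : ℝ, 0 ≤ v → 0 ≤ 1 - Real.exp (-(x ^ 2 * v) / 2) := fun x v hv => by
    have : Real.exp (-(x ^ 2 * v) / 2) ≤ 1 := Real.exp_le_one_iff.2 (by
      have : 0 ≤ x ^ 2 * v := by positivity
      linarith)
    linarith
  have hVa : 0 ≤ ∑ i, a i ^ 2 := by positivity
  have hVb : 0 ≤ ∑ i, b i ^ 2 := by positivity
  have hinner : ∀ p : ℝ × ℝ, ∫⁻ r, ENNReal.ofReal ((1 - Real.cos (p.1 * ∑ i, a i * r i))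
          * (1 - Real.cos (p.2 * ∑ i, b i * r i))) ∂stdGaussianPi n
      = ENNReal.ofReal (1 - Real.exp (-(p.1 ^ 2 * ∑ i, a i ^ 2) / 2))
          * ENNReal.ofReal (1 - Real.exp (-(p.2 ^ 2 * ∑ i, b i ^ 2) / 2))
        + ENNReal.ofReal (Real.exp (-(p.1 ^ 2 * ∑ i, a i ^ 2 + p.2 ^ 2 * ∑ i, b i ^ 2) / 2)
          * (Real.cosh (p.1 * p.2 * ∑ i, a i * b i) - 1)) := fun p => by
    rw [← ofReal_integral_eq_lintegral_ofReal, integral_one_sub_cos_mul,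
      ENNReal.ofReal_add, ENNReal.ofReal_mul (hexp _ _ hVa)]
    · exact mul_nonneg (hexp _ _ hVa) (hexp _ _ hVb)
    · exact mul_nonneg (Real.exp_pos _).le (sub_nonneg.2 (Real.one_le_cosh _))
    · refine Integrable.of_bound (C := 2 * 2) (by fun_prop : Continuous _).aestronglyMeasurable
        (ae_of_all _ fun r => ?_)
      rw [norm_mul]
      have h2 : ∀ x : ℝ, ‖1 - Real.cos x‖ ≤ 2 := fun x => by
        rw [Real.norm_of_nonneg (hnn x)]; linarith [Real.neg_one_le_cos x]
      exact mul_le_mul (h2 _) (h2 _) (norm_nonneg _) (by norm_num)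
    · exact ae_of_all _ fun r => mul_nonneg (hnn _) (hnn _)
  simp_rw [hinner]
  rw [lintegral_add_left (by fun_prop), lintegral_prod (fun p : ℝ × ℝ => ENNReal.ofReal
    (Real.exp _ * (Real.cosh _ - 1))) (by fun_prop)]
  congr 1
  exact lintegral_prod_mul
    (f := fun t => ENNReal.ofReal (1 - Real.exp (-(t ^ 2 * ∑ i, a i ^ 2) / 2)))
    (g := fun s => ENNReal.ofReal (1 - Real.exp (-(s ^ 2 * ∑ i, b i ^ 2) / 2)))
    (by fun_prop) (by fun_prop)

theorem lintegral_mixed_moment_bounds (h0 : 0 < α) (h2 : α < 2) (a b : Fin n → ℝ) :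
    let m := Real.sqrt (∑ i, a i ^ 2) ^ α * Real.sqrt (∑ i, b i ^ 2) ^ α
    let ℓ := ∫ z : ℝ, |z| ^ α ∂gaussianReal 0 1
    let Q := ∫⁻ r, ENNReal.ofReal (|∑ i, a i * r i| ^ α * |∑ i, b i * r i| ^ α) ∂stdGaussianPi n
    ENNReal.ofReal (m * ℓ ^ 2) ≤ Q ∧
    Q ≤ ENNReal.ofReal (m * ℓ ^ 2
      + (∑ i, a i * b i) ^ 2 / ((∑ i, a i ^ 2) * ∑ i, b i ^ 2) * m
        * ∫ z : ℝ, |z| ^ (2 * α) ∂gaussianReal 0 1) := by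
  intro m ℓ Q
  have hℓ : 0 ≤ ℓ := integral_nonneg fun z => by positivity
  have hD : 0 ≤ ∫ z : ℝ, |z| ^ (2 * α) ∂gaussianReal 0 1 :=
    integral_nonneg fun z => by positivity
  have hVa : 0 ≤ ∑ i, a i ^ 2 := by positivity
  have hVb : 0 ≤ ∑ i, b i ^ 2 := by positivity
  have hm : 0 ≤ m := by positivity
  set K := levyConst α * levyConst α
  have hK0 : K ≠ 0 := mul_ne_zero levyConst_ne_zero levyConst_ne_zero
  have hKt : K ≠ ⊤ := ENNReal.mul_ne_top (levyConst_ne_top h0 h2) (levyConst_ne_top h0 h2)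
  have hid : ∀ a b : Fin n → ℝ,
      K * ∫⁻ r, ENNReal.ofReal (|∑ i, a i * r i| ^ α * |∑ i, b i * r i| ^ α) ∂stdGaussianPi n
      = K * ENNReal.ofReal (Real.sqrt (∑ i, a i ^ 2) ^ α * Real.sqrt (∑ i, b i ^ 2) ^ α * ℓ ^ 2)
        + levyCov α (∑ i, a i ^ 2) (∑ i, b i ^ 2) (∑ i, a i * b i) := fun a b => by
    have h := levyConst_sq_mul_lintegral h0 a b
    rw [lintegral_abs_dot_rpow a h0, lintegral_abs_dot_rpow b h0,
      ← ENNReal.ofReal_mul (by positivity)] at h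
    simp_rw [← ENNReal.ofReal_mul (Real.rpow_nonneg (abs_nonneg _) α)] at h
    rw [h, mul_mul_mul_comm (Real.sqrt _ ^ α), ← sq ℓ]
  clear_value K
  have hQ := hid a b
  refine ⟨?_, ?_⟩
  · rw [← ENNReal.mul_le_mul_iff_right hK0 hKt, hQ]
    exact le_self_add
  rw [← ENNReal.mul_le_mul_iff_right hK0 hKt, hQ, ENNReal.ofReal_add (by positivity) (by positivity),
    mul_add]
  gcongr
  rcases eq_or_ne (∑ i, a i * b i) 0 with hc | hc
  · simp [hc, levyCov_zero]
  have hcs : (∑ i, a i * b i) ^ 2 ≤ (∑ i, a i ^ 2) * ∑ i, b i ^ 2 :=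
    Finset.sum_mul_sq_le_sq_mul_sq _ _ _
  have hpos : 0 < (∑ i, a i ^ 2) * ∑ i, b i ^ 2 := lt_of_lt_of_le (by positivity) hcs
  have hVa' : 0 < ∑ i, a i ^ 2 := hVa.lt_of_ne' (left_ne_zero_of_mul hpos.ne')
  set x := Real.sqrt (∑ i, a i ^ 2) with hx
  set y := Real.sqrt (∑ i, b i ^ 2) with hy
  have hx2 : x ^ 2 = ∑ i, a i ^ 2 := Real.sq_sqrt hVa
  have hy2 : y ^ 2 = ∑ i, b i ^ 2 := Real.sq_sqrt hVb
  have hx0 : 0 < x := Real.sqrt_pos.2 hVa'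
  have hy0 : 0 ≤ y := Real.sqrt_nonneg _
  have hy0' : y ≠ 0 := fun h => by
    rw [← hy2, h] at hpos
    simp at hpos
  have hpar := hid a (fun i => y / x * a i)
  have e1 : ∑ i, (y / x * a i) ^ 2 = ∑ i, b i ^ 2 := by
    simp_rw [mul_pow, ← Finset.mul_sum]
    rw [← hx2, ← hy2]
    field_simp
  have e2 : ∑ i, a i * (y / x * a i) = x * y := by
    simp_rw [mul_left_comm (a _), ← Finset.mul_sum, ← sq]
    rw [← hx2]
    field_simp
  have e3 : ∀ r : Fin n → ℝ, |∑ i, a i * r i| ^ α * |∑ i, y / x * a i * r i| ^ α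
      = (y / x) ^ α * |∑ i, a i * r i| ^ (2 * α) := fun r => by
    simp_rw [mul_assoc, ← Finset.mul_sum]
    rw [abs_mul, abs_of_nonneg (div_nonneg hy0 hx0.le),
      Real.mul_rpow (div_nonneg hy0 hx0.le) (abs_nonneg _), two_mul, Real.rpow_add_of_nonneg (abs_nonneg _) h0.le h0.le]
    ring
  rw [e1, e2] at hpar
  simp_rw [e3, ENNReal.ofReal_mul (Real.rpow_nonneg (div_nonneg hy0 hx0.le) α)] at hpar
  rw [lintegral_const_mul _ (by fun_prop), lintegral_abs_dot_rpow a (by positivity)] at hpar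
  have hcov : levyCov α (∑ i, a i ^ 2) (∑ i, b i ^ 2) (x * y)
      ≤ K * ENNReal.ofReal (m * ∫ z : ℝ, |z| ^ (2 * α) ∂gaussianReal 0 1) := by
    refine (le_add_self.trans hpar.symm.le).trans_eq ?_
    rw [← ENNReal.ofReal_mul (by positivity), ← mul_assoc]
    have e4 : (y / x) ^ α * Real.sqrt (∑ i, a i ^ 2) ^ (2 * α) = m := ?_
    rw [e4]
    rw [Real.div_rpow hy0 hx0.le, ← hx, two_mul, Real.rpow_add hx0]
    rw [show m = x ^ α * y ^ α from rfl]
    field_simp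
  have hρ : |(∑ i, a i * b i) / (x * y)| ≤ 1 := by
    rw [← sq_le_one_iff_abs_le_one, div_pow, mul_pow, hx2, hy2]
    exact div_le_one_of_le₀ hcs hpos.le
  calc levyCov α (∑ i, a i ^ 2) (∑ i, b i ^ 2) (∑ i, a i * b i)
      = levyCov α (∑ i, a i ^ 2) (∑ i, b i ^ 2) ((∑ i, a i * b i) / (x * y) * (x * y)) := by
        rw [div_mul_cancel₀ _ (by positivity)]
    _ ≤ _ := levyCov_mul_le hρ _ _ _
    _ ≤ _ := mul_le_mul_right hcov _
    _ = _ := by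
        rw [mul_left_comm _ K, ← ENNReal.ofReal_mul (by positivity), div_pow, mul_pow, hx2, hy2,
          mul_assoc _ m]

theorem integrable_abs_dot_rpow (h0 : 0 < α) (a : Fin n → ℝ) :
    Integrable (fun r => |∑ i, a i * r i| ^ α) (stdGaussianPi n) := by
  refine ⟨(by fun_prop : Measurable _).aestronglyMeasurable, ?_⟩
  rw [hasFiniteIntegral_iff_ofReal (ae_of_all _ fun r => by positivity),
    lintegral_abs_dot_rpow a h0]
  exact ENNReal.ofReal_lt_top

theorem integral_abs_dot_rpow (h0 : 0 < α) (a : Fin n → ℝ) :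
    ∫ r, |∑ i, a i * r i| ^ α ∂stdGaussianPi n
      = Real.sqrt (∑ i, a i ^ 2) ^ α * ∫ z : ℝ, |z| ^ α ∂gaussianReal 0 1 := by
  have hℓ : 0 ≤ ∫ z : ℝ, |z| ^ α ∂gaussianReal 0 1 := integral_nonneg fun z => by positivity
  rw [integral_eq_lintegral_of_nonneg_ae (ae_of_all _ fun r => by positivity)
    (integrable_abs_dot_rpow h0 a).1, lintegral_abs_dot_rpow a h0,
    ENNReal.toReal_ofReal (by positivity)]

theorem abs_integral_centered_le (h0 : 0 < α) (h2 : α < 2) (a b : Fin n → ℝ) :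
    let x := Real.sqrt (∑ i, a i ^ 2)
    let y := Real.sqrt (∑ i, b i ^ 2)
    let ℓ := ∫ z : ℝ, |z| ^ α ∂gaussianReal 0 1
    |∫ r, (|∑ i, a i * r i| ^ α - ℓ) * (|∑ i, b i * r i| ^ α - ℓ) ∂stdGaussianPi n|
      ≤ (∑ i, a i * b i) ^ 2 / ((∑ i, a i ^ 2) * ∑ i, b i ^ 2) * (x ^ α * y ^ α)
          * (∫ z : ℝ, |z| ^ (2 * α) ∂gaussianReal 0 1)
        + ℓ ^ 2 * (|x ^ α - 1| * |y ^ α - 1|) := by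
  intro x y ℓ
  obtain ⟨hlow, hupp⟩ := lintegral_mixed_moment_bounds h0 h2 a b
  have hD : 0 ≤ ∫ z : ℝ, |z| ^ (2 * α) ∂gaussianReal 0 1 :=
    integral_nonneg fun z => by positivity
  have hx0 : 0 ≤ x := Real.sqrt_nonneg _
  have hy0 : 0 ≤ y := Real.sqrt_nonneg _
  have hnn : 0 ≤ᵐ[stdGaussianPi n] fun r => |∑ i, a i * r i| ^ α * |∑ i, b i * r i| ^ α :=
    ae_of_all _ fun r => by positivity
  have hi : Integrable (fun r => |∑ i, a i * r i| ^ α * |∑ i, b i * r i| ^ α)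
      (stdGaussianPi n) := by
    refine ⟨(by fun_prop : Measurable _).aestronglyMeasurable, ?_⟩
    rw [hasFiniteIntegral_iff_ofReal hnn]
    exact hupp.trans_lt ENNReal.ofReal_lt_top
  have hQ := ofReal_integral_eq_lintegral_ofReal hi hnn
  rw [← hQ] at hlow hupp
  rw [ENNReal.ofReal_le_ofReal_iff (by positivity)] at hupp
  rw [ENNReal.ofReal_le_ofReal_iff (integral_nonneg fun r => by positivity)] at hlow
  have ia := (integrable_abs_dot_rpow h0 a).mul_const ℓ
  have ib := (integrable_abs_dot_rpow h0 b).mul_const ℓ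
  have e : ∀ r : Fin n → ℝ, (|∑ i, a i * r i| ^ α - ℓ) * (|∑ i, b i * r i| ^ α - ℓ)
      = |∑ i, a i * r i| ^ α * |∑ i, b i * r i| ^ α - |∑ i, a i * r i| ^ α * ℓ
        - |∑ i, b i * r i| ^ α * ℓ + ℓ ^ 2 := fun r => by ring
  have i1 : Integrable (fun r => |∑ i, a i * r i| ^ α * |∑ i, b i * r i| ^ α
    - |∑ i, a i * r i| ^ α * ℓ) (stdGaussianPi n) := hi.sub ia
  have i2 : Integrable (fun r => |∑ i, a i * r i| ^ α * |∑ i, b i * r i| ^ α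
    - |∑ i, a i * r i| ^ α * ℓ - |∑ i, b i * r i| ^ α * ℓ) (stdGaussianPi n) := i1.sub ib
  simp_rw [e]
  rw [integral_add i2 (integrable_const _), integral_sub i1 ib, integral_sub hi ia,
    integral_mul_const, integral_mul_const, integral_abs_dot_rpow h0, integral_abs_dot_rpow h0]
  simp only [integral_const, probReal_univ, one_smul]
  set q := ∫ r, |∑ i, a i * r i| ^ α * |∑ i, b i * r i| ^ α ∂stdGaussianPi n
  have e2 : q - x ^ α * ℓ * ℓ - y ^ α * ℓ * ℓ + ℓ ^ 2
      = (q - x ^ α * y ^ α * ℓ ^ 2) + ℓ ^ 2 * ((x ^ α - 1) * (y ^ α - 1)) := by ring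
  refine (congrArg abs e2).trans_le ((abs_add_le _ _).trans (add_le_add ?_ ?_))
  · rw [abs_of_nonneg (sub_nonneg.2 hlow)]
    exact sub_le_iff_le_add'.2 hupp
  · rw [abs_mul, abs_mul, abs_of_nonneg (sq_nonneg ℓ)]

end Moments

theorem sqrt_rpow_le_one_add {α : ℝ} (h0 : 0 < α) (h2 : α < 2) {v : ℝ} (hv : 0 ≤ v) :
    Real.sqrt v ^ α ≤ 1 + v := by
  rw [Real.sqrt_eq_rpow, ← Real.rpow_mul hv]
  rcases le_total v 1 with h | h
  · linarith [Real.rpow_le_one hv h (by positivity : 0 ≤ 1 / 2 * α)]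
  · have := Real.rpow_le_rpow_of_exponent_le h (by linarith : 1 / 2 * α ≤ 1)
    rw [Real.rpow_one] at this
    linarith

theorem abs_sqrt_rpow_sub_one_le {α : ℝ} (h0 : 0 < α) (h2 : α < 2) {v : ℝ} (hv : 0 ≤ v) :
    |Real.sqrt v ^ α - 1| ≤ |v - 1| := by
  rw [Real.sqrt_eq_rpow, ← Real.rpow_mul hv]
  rcases le_total v 1 with h | h
  · have h1 := Real.rpow_le_one hv h (by positivity : 0 ≤ 1 / 2 * α)
    have h3 := Real.rpow_le_rpow_of_exponent_ge_of_imp hv h (by linarith : 1 / 2 * α ≤ 1)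
      (fun _ h => by linarith)
    rw [Real.rpow_one] at h3
    rw [abs_of_nonpos (by linarith), abs_of_nonpos (by linarith)]
    linarith
  · have h1 := Real.one_le_rpow h (by positivity : 0 ≤ 1 / 2 * α)
    have h3 := Real.rpow_le_rpow_of_exponent_le h (by linarith : 1 / 2 * α ≤ 1)
    rw [Real.rpow_one] at h3
    rw [abs_of_nonneg (by linarith), abs_of_nonneg (by linarith)]
    linarith

theorem sq_div_mul_le {v w c : ℝ} (hv : 0 ≤ v) (hw : 0 ≤ w) (hc : c ^ 2 ≤ v * w) :
    c ^ 2 / (v * w) ≤ 4 * (c ^ 2 + (v - 1) ^ 2 + (w - 1) ^ 2) := by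
  have hle : c ^ 2 / (v * w) ≤ 1 := div_le_one_of_le₀ hc (by positivity)
  rcases lt_or_ge v (1 / 2) with h | h
  · nlinarith [sq_nonneg c, sq_nonneg (w - 1)]
  rcases lt_or_ge w (1 / 2) with h' | h'
  · nlinarith [sq_nonneg c, sq_nonneg (v - 1)]
  rw [div_le_iff₀ (by positivity)]
  have hvw : 1 / 4 ≤ v * w := by nlinarith
  have : c ^ 2 ≤ 4 * c ^ 2 * (v * w) := by nlinarith [sq_nonneg c]
  have : 0 ≤ (4 * (v - 1) ^ 2 + 4 * (w - 1) ^ 2) * (v * w) := by positivity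
  nlinarith

section ExponentialMoments

theorem inv_sqrt_one_sub_le {u : ℝ} (hu : u ≤ 1 / 2) :
    (Real.sqrt (1 - u))⁻¹ ≤ Real.exp (u / 2 + u ^ 2) := by
  have h1 : 1 ≤ (1 - u) * Real.exp (u + 2 * u ^ 2) := by
    have := Real.add_one_le_exp (u + 2 * u ^ 2)
    nlinarith [mul_nonneg (sq_nonneg u) (by linarith : 0 ≤ 1 - 2 * u)]
  have h2 : 0 < Real.sqrt (1 - u) := Real.sqrt_pos.2 (by linarith)
  rw [inv_le_iff_one_le_mul₀ h2]
  refine le_of_sq_le_sq ?_ (by positivity)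
  rw [mul_pow, Real.sq_sqrt (by linarith), ← Real.exp_nat_mul, one_pow, mul_comm]
  have e : ((2 : ℕ) : ℝ) * (u / 2 + u ^ 2) = u + 2 * u ^ 2 := by
    push_cast
    ring
  rw [e]
  linarith

theorem lintegral_exp_sq_gaussianReal_le {t : ℝ} (ht : t ≤ 1 / 4) :
    ∫⁻ z, ENNReal.ofReal (Real.exp (t * z ^ 2)) ∂gaussianReal 0 1
      ≤ ENNReal.ofReal (Real.exp (t + 4 * t ^ 2)) := by
  have hb : 0 < 1 / 2 - t := by linarith
  rw [gaussianReal_of_var_ne_zero _ one_ne_zero,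
    lintegral_withDensity_eq_lintegral_mul _ (measurable_gaussianPDF _ _) (by fun_prop)]
  have e : ∀ z : ℝ, (gaussianPDF 0 1 * fun z => ENNReal.ofReal (Real.exp (t * z ^ 2))) z
      = ENNReal.ofReal ((Real.sqrt (2 * Real.pi))⁻¹ * Real.exp (-(1 / 2 - t) * z ^ 2)) :=
    fun z => by
      simp only [Pi.mul_apply, gaussianPDF, gaussianPDFReal]
      rw [← ENNReal.ofReal_mul (by positivity), mul_assoc, ← Real.exp_add]
      simp only [NNReal.coe_one, mul_one, sub_zero]
      congr 3
      ring
  simp_rw [e]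
  rw [← ofReal_integral_eq_lintegral_ofReal ((integrable_exp_neg_mul_sq hb).const_mul _)
    (ae_of_all _ fun z => by positivity), integral_const_mul, integral_gaussian]
  refine ENNReal.ofReal_le_ofReal ?_
  have e2 : (Real.sqrt (2 * Real.pi))⁻¹ * Real.sqrt (Real.pi / (1 / 2 - t))
      = (Real.sqrt (1 - 2 * t))⁻¹ := by
    rw [← Real.sqrt_inv, ← Real.sqrt_inv, ← Real.sqrt_mul (by positivity)]
    congr 1
    have : 1 - 2 * t ≠ 0 := by linarith
    field_simp
  rw [e2]
  exact (inv_sqrt_one_sub_le (u := 2 * t) (by linarith)).trans_eq (congrArg _ (by ring))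

variable {n : ℕ}

theorem lintegral_exp_sum_sq_le {t : ℝ} (ht : t ≤ 1 / 4) :
    ∫⁻ r, ENNReal.ofReal (Real.exp (t * ∑ i, r i ^ 2)) ∂stdGaussianPi n
      ≤ ENNReal.ofReal (Real.exp (n * (t + 4 * t ^ 2))) := by
  have hle := lintegral_exp_sq_gaussianReal_le ht
  have hnn : 0 ≤ᵐ[gaussianReal 0 1] fun z => Real.exp (t * z ^ 2) :=
    ae_of_all _ fun z => (Real.exp_pos _).le
  have hi : Integrable (fun z => Real.exp (t * z ^ 2)) (gaussianReal 0 1) := by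
    refine ⟨(by fun_prop : Measurable _).aestronglyMeasurable, ?_⟩
    rw [hasFiniteIntegral_iff_ofReal hnn]
    exact hle.trans_lt ENNReal.ofReal_lt_top
  rw [← ofReal_integral_eq_lintegral_ofReal hi hnn,
    ENNReal.ofReal_le_ofReal_iff (Real.exp_pos _).le] at hle
  simp_rw [Finset.mul_sum, Real.exp_sum]
  rw [← ofReal_integral_eq_lintegral_ofReal (Integrable.fintype_prod fun _ => hi)
    (ae_of_all _ fun r => by positivity),
    integral_fintype_prod_eq_prod (fun _ (z : ℝ) => Real.exp (t * z ^ 2))]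
  refine ENNReal.ofReal_le_ofReal ?_
  rw [Finset.prod_const, Finset.card_univ, Fintype.card_fin, Real.exp_nat_mul]
  exact pow_le_pow_left₀ (integral_nonneg fun z => (Real.exp_pos _).le) hle _

theorem lintegral_exp_chi_le (hn : 0 < n) {t : ℝ} (ht : |t| = 1 / 4) :
    ∫⁻ r, ENNReal.ofReal (Real.exp (t * ((∑ i, r i ^ 2 - n) / Real.sqrt n))) ∂stdGaussianPi n
      ≤ ENNReal.ofReal (Real.exp 1) := by
  have hn1 : (1 : ℝ) ≤ n := by exact_mod_cast hn
  have hs1 : 1 ≤ Real.sqrt n := Real.one_le_sqrt.2 hn1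
  have hs2 : Real.sqrt n ^ 2 = n := Real.sq_sqrt (by linarith)
  have ht' : t / Real.sqrt n ≤ 1 / 4 :=
    (le_abs_self _).trans (by
      rw [abs_div, ht, abs_of_pos (by linarith)]
      exact div_le_self (by norm_num) hs1)
  have ht2 : t ^ 2 = 1 / 16 := by rw [← sq_abs, ht]; norm_num
  have e : ∀ r : Fin n → ℝ,
      ENNReal.ofReal (Real.exp (t * ((∑ i, r i ^ 2 - n) / Real.sqrt n)))
      = ENNReal.ofReal (Real.exp (-(n * (t / Real.sqrt n))))
        * ENNReal.ofReal (Real.exp (t / Real.sqrt n * ∑ i, r i ^ 2)) := fun r => by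
    rw [← ENNReal.ofReal_mul (Real.exp_pos _).le, ← Real.exp_add]
    congr 2
    ring
  simp_rw [e]
  rw [lintegral_const_mul _ (by fun_prop)]
  refine (mul_le_mul_right (lintegral_exp_sum_sq_le ht') _).trans ?_
  rw [← ENNReal.ofReal_mul (Real.exp_pos _).le, ← Real.exp_add]
  refine ENNReal.ofReal_le_ofReal (Real.exp_le_exp.2 ?_)
  have : (n : ℝ) * (4 * (t / Real.sqrt n) ^ 2) = 1 / 4 := by
    rw [div_pow, hs2, ht2]
    field_simp
    norm_num
  linarith

theorem lintegral_exp_dot_le (hn : 0 < n) {t : ℝ} (ht : |t| = 1 / 4) :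
    ∫⁻ p : (Fin n → ℝ) × (Fin n → ℝ),
        ENNReal.ofReal (Real.exp (t * ((∑ i, p.1 i * p.2 i) / Real.sqrt n)))
        ∂(stdGaussianPi n).prod (stdGaussianPi n)
      ≤ ENNReal.ofReal (Real.exp 1) := by
  have hn1 : (1 : ℝ) ≤ n := by exact_mod_cast hn
  have hs1 : 1 ≤ Real.sqrt n := Real.one_le_sqrt.2 hn1
  have hs2 : Real.sqrt n ^ 2 = n := Real.sq_sqrt (by linarith)
  have ht2 : t ^ 2 = 1 / 16 := by rw [← sq_abs, ht]; norm_num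
  rw [lintegral_prod _ (by fun_prop)]
  have e : ∀ a : Fin n → ℝ,
      ∫⁻ b, ENNReal.ofReal (Real.exp (t * ((∑ i, a i * b i) / Real.sqrt n))) ∂stdGaussianPi n
      = ENNReal.ofReal (Real.exp (1 / (32 * n) * ∑ i, a i ^ 2)) := fun a => by
    have hV : 0 ≤ ∑ i, a i ^ 2 := by positivity
    rw [lintegral_dot a (f := fun x => ENNReal.ofReal (Real.exp (t * (x / Real.sqrt n))))
      (by fun_prop)]
    have e1 : ∀ z : ℝ, t * (Real.sqrt (∑ i, a i ^ 2) * z / Real.sqrt n)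
        = t * Real.sqrt (∑ i, a i ^ 2) / Real.sqrt n * z := fun z => by ring
    simp_rw [e1]
    rw [← ofReal_integral_eq_lintegral_ofReal (integrable_exp_mul_gaussianReal _)
      (ae_of_all _ fun z => (Real.exp_pos _).le)]
    have := mgf_gaussianReal (X := id) (p := gaussianReal 0 1) (μ := 0) (v := 1) Measure.map_id
      (t * Real.sqrt (∑ i, a i ^ 2) / Real.sqrt n)
    simp only [mgf, id] at this
    rw [this, div_pow, mul_pow, hs2, ht2, Real.sq_sqrt hV]
    congr 2
    simp
    ring
  simp_rw [e]
  have hle : 1 / (32 * (n : ℝ)) ≤ 1 / 32 := by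
    rw [div_le_div_iff₀ (by positivity) (by positivity)]; linarith
  refine (lintegral_exp_sum_sq_le (by linarith)).trans
    (ENNReal.ofReal_le_ofReal (Real.exp_le_exp.2 ?_))
  have e2 : (n : ℝ) * (1 / (32 * n)) = 1 / 32 := by field_simp
  have h0 : 0 ≤ 1 / (32 * (n : ℝ)) := by positivity
  nlinarith

end ExponentialMoments

section UniformBound

variable {α : ℝ} {n : ℕ}

theorem exp_abs_le (x : ℝ) : Real.exp |x| ≤ Real.exp x + Real.exp (-x) := by
  rcases abs_cases x with ⟨h, _⟩ | ⟨h, _⟩ <;> rw [h] <;> linarith [Real.exp_pos x, Real.exp_pos (-x)]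

theorem exp_sum_abs_le (x y z : ℝ) :
    Real.exp (1 / 12 * (|x| + |y| + |z|))
      ≤ Real.exp (1 / 4 * x) + Real.exp (-(1 / 4) * x) + (Real.exp (1 / 4 * y)
        + Real.exp (-(1 / 4) * y)) + (Real.exp (1 / 4 * z) + Real.exp (-(1 / 4) * z)) := by
  have h : ∀ u : ℝ, Real.exp (1 / 4 * |u|) ≤ Real.exp (1 / 4 * u) + Real.exp (-(1 / 4) * u) :=
    fun u => by
      have := exp_abs_le (1 / 4 * u)
      rwa [abs_mul, abs_of_pos (by norm_num : (0 : ℝ) < 1 / 4), ← neg_mul] at this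
  have hx := h x
  have hy := h y
  have hz := h z
  have px := Real.exp_pos (1 / 4 * |x|)
  have py := Real.exp_pos (1 / 4 * |y|)
  have pz := Real.exp_pos (1 / 4 * |z|)
  have hmax : ∀ w : ℝ, |x| ≤ w → |y| ≤ w → |z| ≤ w →
      Real.exp (1 / 12 * (|x| + |y| + |z|)) ≤ Real.exp (1 / 4 * w) := fun w h1 h2 h3 =>
    Real.exp_le_exp.2 (by linarith)
  rcases le_total |x| |y| with h1 | h1
  · rcases le_total |y| |z| with h2 | h2
    · linarith [hmax |z| (h1.trans h2) h2 le_rfl]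
    · linarith [hmax |y| h1 le_rfl h2]
  · rcases le_total |x| |z| with h2 | h2
    · linarith [hmax |z| h2 (h1.trans h2) le_rfl]
    · linarith [hmax |x| le_rfl h1 h2]

/-- Sum of the normalized fluctuations of `‖a‖²`, `‖b‖²` and `⟨a, b⟩`. -/
noncomputable def fluctuation (p : (Fin n → ℝ) × (Fin n → ℝ)) : ℝ :=
  |(∑ i, p.1 i ^ 2 - n) / Real.sqrt n| + |(∑ i, p.2 i ^ 2 - n) / Real.sqrt n|
    + |(∑ i, p.1 i * p.2 i) / Real.sqrt n|

theorem fluctuation_nonneg (p : (Fin n → ℝ) × (Fin n → ℝ)) : 0 ≤ fluctuation p := by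
  unfold fluctuation
  positivity

theorem lintegral_exp_fluctuation_le (hn : 0 < n) :
    ∫⁻ p, ENNReal.ofReal (Real.exp (1 / 12 * fluctuation p))
        ∂(stdGaussianPi n).prod (stdGaussianPi n)
      ≤ ENNReal.ofReal (6 * Real.exp 1) := by
  have hfst : ∀ t : ℝ, |t| = 1 / 4 → ∫⁻ p : (Fin n → ℝ) × (Fin n → ℝ),
      ENNReal.ofReal (Real.exp (t * ((∑ i, p.1 i ^ 2 - n) / Real.sqrt n)))
        ∂(stdGaussianPi n).prod (stdGaussianPi n) ≤ ENNReal.ofReal (Real.exp 1) := fun t ht => by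
    rw [lintegral_prod _ (by fun_prop)]
    simpa using lintegral_exp_chi_le hn ht
  have hsnd : ∀ t : ℝ, |t| = 1 / 4 → ∫⁻ p : (Fin n → ℝ) × (Fin n → ℝ),
      ENNReal.ofReal (Real.exp (t * ((∑ i, p.2 i ^ 2 - n) / Real.sqrt n)))
        ∂(stdGaussianPi n).prod (stdGaussianPi n) ≤ ENNReal.ofReal (Real.exp 1) := fun t ht => by
    rw [lintegral_prod _ (by fun_prop)]
    simpa using lintegral_exp_chi_le hn ht
  have h1 : |(1 / 4 : ℝ)| = 1 / 4 := by norm_num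
  have h2 : |(-(1 / 4) : ℝ)| = 1 / 4 := by norm_num
  calc _ ≤ ∫⁻ p : (Fin n → ℝ) × (Fin n → ℝ), (
        ENNReal.ofReal (Real.exp (1 / 4 * ((∑ i, p.1 i ^ 2 - n) / Real.sqrt n)))
        + ENNReal.ofReal (Real.exp (-(1 / 4) * ((∑ i, p.1 i ^ 2 - n) / Real.sqrt n)))
        + (ENNReal.ofReal (Real.exp (1 / 4 * ((∑ i, p.2 i ^ 2 - n) / Real.sqrt n)))
        + ENNReal.ofReal (Real.exp (-(1 / 4) * ((∑ i, p.2 i ^ 2 - n) / Real.sqrt n))))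
        + (ENNReal.ofReal (Real.exp (1 / 4 * ((∑ i, p.1 i * p.2 i) / Real.sqrt n)))
        + ENNReal.ofReal (Real.exp (-(1 / 4) * ((∑ i, p.1 i * p.2 i) / Real.sqrt n)))))
        ∂(stdGaussianPi n).prod (stdGaussianPi n) := by
        refine lintegral_mono fun p => ?_
        refine (ENNReal.ofReal_le_ofReal (exp_sum_abs_le _ _ _)).trans_eq ?_
        repeat rw [ENNReal.ofReal_add (by positivity) (by positivity)]
    _ ≤ ENNReal.ofReal (Real.exp 1) + ENNReal.ofReal (Real.exp 1)
        + (ENNReal.ofReal (Real.exp 1) + ENNReal.ofReal (Real.exp 1))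
        + (ENNReal.ofReal (Real.exp 1) + ENNReal.ofReal (Real.exp 1)) := by
        rw [lintegral_add_left (by fun_prop), lintegral_add_left (by fun_prop),
          lintegral_add_left (by fun_prop), lintegral_add_left (by fun_prop),
          lintegral_add_left (by fun_prop)]
        exact add_le_add (add_le_add (add_le_add (hfst _ h1) (hfst _ h2))
          (add_le_add (hsnd _ h1) (hsnd _ h2)))
          (add_le_add (lintegral_exp_dot_le hn h1) (lintegral_exp_dot_le hn h2))
    _ = _ := by
        repeat rw [← ENNReal.ofReal_add (by positivity) (by positivity)]
        congr 1
        ring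

theorem covariance_bound_le (h0 : 0 < α) (h2 : α < 2) {v w c ℓ D : ℝ} (hv0 : 0 ≤ v)
    (hw0 : 0 ≤ w) (hD : 0 ≤ D) (hcs : c ^ 2 ≤ v * w) :
    c ^ 2 / (v * w) * (Real.sqrt v ^ α * Real.sqrt w ^ α) * D
        + ℓ ^ 2 * (|Real.sqrt v ^ α - 1| * |Real.sqrt w ^ α - 1|)
      ≤ (4 * D + ℓ ^ 2) * ((c ^ 2 + (v - 1) ^ 2 + (w - 1) ^ 2) * ((1 + v) * (1 + w))) := by
  set δ := c ^ 2 + (v - 1) ^ 2 + (w - 1) ^ 2 with hδ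
  have hδ0 : 0 ≤ δ := by positivity
  have hm1 : 1 ≤ (1 + v) * (1 + w) := by nlinarith [mul_nonneg hv0 hw0]
  have b1 : c ^ 2 / (v * w) * (Real.sqrt v ^ α * Real.sqrt w ^ α)
      ≤ 4 * δ * ((1 + v) * (1 + w)) := by
    refine mul_le_mul (sq_div_mul_le hv0 hw0 hcs) (mul_le_mul (sqrt_rpow_le_one_add h0 h2 hv0)
      (sqrt_rpow_le_one_add h0 h2 hw0) (by positivity) (by positivity)) (by positivity)
      (by positivity)
  have b2 : |Real.sqrt v ^ α - 1| * |Real.sqrt w ^ α - 1| ≤ δ * ((1 + v) * (1 + w)) := by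
    have b3 : |Real.sqrt v ^ α - 1| * |Real.sqrt w ^ α - 1| ≤ |v - 1| * |w - 1| :=
      mul_le_mul (abs_sqrt_rpow_sub_one_le h0 h2 hv0) (abs_sqrt_rpow_sub_one_le h0 h2 hw0)
        (abs_nonneg _) (abs_nonneg _)
    have b4 : |v - 1| * |w - 1| ≤ δ := by
      rw [hδ, ← sq_abs (v - 1), ← sq_abs (w - 1)]
      nlinarith [sq_nonneg (|v - 1| - |w - 1|), sq_nonneg c]
    exact b3.trans (b4.trans (le_mul_of_one_le_right hδ0 hm1))
  have b5 := mul_le_mul_of_nonneg_right b1 hD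
  have b6 := mul_le_mul_of_nonneg_left b2 (sq_nonneg ℓ)
  linarith

theorem abs_mul_integral_centered_le (h0 : 0 < α) (h2 : α < 2) (hn : 0 < n)
    (p : (Fin n → ℝ) × (Fin n → ℝ)) :
    |(n : ℝ) * ∫ r : Fin n → ℝ,
        (|(∑ i, p.1 i * r i) / Real.sqrt n| ^ α - ∫ z : ℝ, |z| ^ α ∂gaussianReal 0 1)
        * (|(∑ i, r i * p.2 i) / Real.sqrt n| ^ α - ∫ z : ℝ, |z| ^ α ∂gaussianReal 0 1)
        ∂stdGaussianPi n|
      ≤ (4 * (∫ z : ℝ, |z| ^ (2 * α) ∂gaussianReal 0 1)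
          + (∫ z : ℝ, |z| ^ α ∂gaussianReal 0 1) ^ 2) * (2 + fluctuation p) ^ 4 := by
  have hn1 : (1 : ℝ) ≤ n := by exact_mod_cast hn
  set s := Real.sqrt n with hs
  have hs1 : 1 ≤ s := Real.one_le_sqrt.2 hn1
  have hs0 : 0 < s := by linarith
  have hs2 : s ^ 2 = n := Real.sq_sqrt (by linarith)
  have h := abs_integral_centered_le h0 h2 (fun i => p.1 i / s) (fun i => p.2 i / s)
  have e1 : ∀ r : Fin n → ℝ, ∑ i, p.1 i / s * r i = (∑ i, p.1 i * r i) / s := fun r => by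
    rw [Finset.sum_div]
    exact Finset.sum_congr rfl fun i _ => by ring
  have e2 : ∀ r : Fin n → ℝ, ∑ i, p.2 i / s * r i = (∑ i, r i * p.2 i) / s := fun r => by
    rw [Finset.sum_div]
    exact Finset.sum_congr rfl fun i _ => by ring
  simp only [e1, e2] at h
  set v := ∑ i, (p.1 i / s) ^ 2 with hv
  set w := ∑ i, (p.2 i / s) ^ 2 with hw
  have e3 : (∑ i, p.1 i * (p.2 i / s)) / s = ∑ i, p.1 i / s * (p.2 i / s) := by
    rw [Finset.sum_div]
    exact Finset.sum_congr rfl fun i _ => by ring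
  rw [e3] at h
  set c := ∑ i, p.1 i / s * (p.2 i / s) with hc
  have hcs : c ^ 2 ≤ v * w := Finset.sum_mul_sq_le_sq_mul_sq _ _ _
  have hv0 : 0 ≤ v := by positivity
  have hw0 : 0 ≤ w := by positivity
  set ℓ := ∫ z : ℝ, |z| ^ α ∂gaussianReal 0 1
  set D := ∫ z : ℝ, |z| ^ (2 * α) ∂gaussianReal 0 1
  have hD : 0 ≤ D := integral_nonneg fun z => by positivity
  set X := fluctuation p with hX
  have eA : (∑ i, p.1 i ^ 2 - n) / s = s * (v - 1) := by
    simp_rw [hv, div_pow, ← Finset.sum_div, hs2]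
    rw [← hs2]
    field_simp
  have eB : (∑ i, p.2 i ^ 2 - n) / s = s * (w - 1) := by
    simp_rw [hw, div_pow, ← Finset.sum_div, hs2]
    rw [← hs2]
    field_simp
  have eT : (∑ i, p.1 i * p.2 i) / s = s * c := by
    rw [hc, Finset.sum_div, Finset.mul_sum]
    refine Finset.sum_congr rfl fun i _ => ?_
    field_simp
  have hXe : X = s * |v - 1| + s * |w - 1| + s * |c| := by
    rw [hX, fluctuation, ← hs, eA, eB, eT, abs_mul, abs_mul, abs_mul, abs_of_pos hs0]
  clear_value v w c X ℓ D
  have av := abs_nonneg (v - 1)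
  have aw := abs_nonneg (w - 1)
  have ac := abs_nonneg c
  have hX0 : 0 ≤ X := by rw [hXe]; positivity
  have hvX : 1 + v ≤ 2 + X := by
    rw [hXe]
    nlinarith [le_abs_self (v - 1), mul_nonneg hs0.le aw, mul_nonneg hs0.le ac]
  have hwX : 1 + w ≤ 2 + X := by
    rw [hXe]
    nlinarith [le_abs_self (w - 1), mul_nonneg hs0.le av, mul_nonneg hs0.le ac]
  set δ := c ^ 2 + (v - 1) ^ 2 + (w - 1) ^ 2 with hδ
  have hδ0 : 0 ≤ δ := by positivity
  have hδX : n * δ ≤ (2 + X) ^ 2 := by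
    have : n * δ ≤ X ^ 2 := by
      rw [hXe, ← hs2, hδ, ← sq_abs c, ← sq_abs (v - 1), ← sq_abs (w - 1)]
      have p1 := mul_nonneg (sq_nonneg s) (mul_nonneg av aw)
      have p2 := mul_nonneg (sq_nonneg s) (mul_nonneg av ac)
      have p3 := mul_nonneg (sq_nonneg s) (mul_nonneg aw ac)
      linarith
    exact this.trans (pow_le_pow_left₀ hX0 (by linarith) 2)
  have hprod : (1 + v) * (1 + w) ≤ (2 + X) ^ 2 := by
    rw [sq]
    exact mul_le_mul hvX hwX (by linarith) (by linarith)
  have hbound := covariance_bound_le h0 h2 (ℓ := ℓ) hv0 hw0 hD hcs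
  rw [abs_mul, abs_of_pos (by linarith : (0 : ℝ) < n)]
  calc (n : ℝ) * _ ≤ n * ((4 * D + ℓ ^ 2) * (δ * ((1 + v) * (1 + w)))) :=
        mul_le_mul_of_nonneg_left (h.trans hbound) (by linarith)
    _ = (4 * D + ℓ ^ 2) * ((n * δ) * ((1 + v) * (1 + w))) := by ring
    _ ≤ (4 * D + ℓ ^ 2) * ((2 + X) ^ 2 * (2 + X) ^ 2) := by gcongr
    _ = _ := by ring

theorem pow_two_add_le_exp {x : ℝ} (hx : 0 ≤ x) (m : ℕ) :
    (2 + x) ^ m ≤ 12 ^ m * m.factorial * Real.exp 1 * Real.exp (1 / 12 * x) := by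
  have h := Real.pow_div_factorial_le_exp ((2 + x) / 12) (by positivity) m
  rw [div_le_iff₀ (by positivity), div_pow, div_le_iff₀ (by positivity)] at h
  have h2 : Real.exp ((2 + x) / 12) ≤ Real.exp 1 * Real.exp (1 / 12 * x) := by
    rw [← Real.exp_add]
    exact Real.exp_le_exp.2 (by linarith)
  calc (2 + x) ^ m ≤ Real.exp ((2 + x) / 12) * m.factorial * 12 ^ m := h
    _ ≤ Real.exp 1 * Real.exp (1 / 12 * x) * m.factorial * 12 ^ m := by gcongr
    _ = _ := by ring

end UniformBound

/-- Let `R₁, R₂, R₃` be independent standard Gaussian vectors in `ℝⁿ`,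
`0 < α < 2`, `ℓ_α = E[|Z|^α]`, and let
`Y = E[(|⟨R₁,R₂⟩/√n|^α − ℓ_α)(|⟨R₂,R₃⟩/√n|^α − ℓ_α) | R₁, R₃]`, realized (by
independence of `R₂` from `(R₁,R₃)`) as the integral over `R₂` of the product,
as a function of `(R₁, R₃)`. Then for every positive integer `k` there exists a
constant `M_k > 0`, independent of `n`, with `|E[(nY)^k]| ≤ M_k` for all `n`. -/
theorem stmt_15 (α : ℝ) (h0 : 0 < α) (h2 : α < 2)
    (ℓ : ℝ) (hℓ : ℓ = ∫ z : ℝ, |z| ^ α ∂(gaussianReal 0 1))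
    (k : ℕ) (hk : 0 < k) :
    ∃ M : ℝ, 0 < M ∧ ∀ n : ℕ, 0 < n →
      |∫ p : (Fin n → ℝ) × (Fin n → ℝ),
          ((n : ℝ) *
            ∫ r₂ : Fin n → ℝ,
              (|(∑ i, p.1 i * r₂ i) / Real.sqrt n| ^ α - ℓ) *
              (|(∑ i, r₂ i * p.2 i) / Real.sqrt n| ^ α - ℓ)
              ∂(Measure.pi fun _ : Fin n => gaussianReal 0 1)) ^ k
          ∂((Measure.pi fun _ : Fin n => gaussianReal 0 1).prod
              (Measure.pi fun _ : Fin n => gaussianReal 0 1))| ≤ M := by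
  subst hℓ
  set C := 4 * (∫ z : ℝ, |z| ^ (2 * α) ∂gaussianReal 0 1)
    + (∫ z : ℝ, |z| ^ α ∂gaussianReal 0 1) ^ 2 with hC
  have hC0 : 0 ≤ C := by
    have : 0 ≤ ∫ z : ℝ, |z| ^ (2 * α) ∂gaussianReal 0 1 := integral_nonneg fun z => by positivity
    positivity
  set B := C ^ k * (12 ^ (4 * k) * (4 * k).factorial * Real.exp 1) with hB
  have hB0 : 0 ≤ B := by positivity
  refine ⟨B * (6 * Real.exp 1) + 1, by positivity, fun n hn => ?_⟩
  suffices h : |∫ p : (Fin n → ℝ) × (Fin n → ℝ), _ ∂_| ≤ B * (6 * Real.exp 1) from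
    h.trans (by linarith)
  rw [← ENNReal.ofReal_le_ofReal_iff (by positivity), ← Real.enorm_eq_ofReal_abs]
  refine (enorm_integral_le_lintegral_enorm _).trans ?_
  calc _ ≤ ∫⁻ p, ENNReal.ofReal B * ENNReal.ofReal (Real.exp (1 / 12 * fluctuation p))
        ∂(stdGaussianPi n).prod (stdGaussianPi n) := by
        refine lintegral_mono fun p => ?_
        rw [Real.enorm_eq_ofReal_abs, ← ENNReal.ofReal_mul hB0, abs_pow]
        refine ENNReal.ofReal_le_ofReal ?_
        calc _ ≤ (C * (2 + fluctuation p) ^ 4) ^ k :=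
              pow_le_pow_left₀ (abs_nonneg _) (abs_mul_integral_centered_le h0 h2 hn p) k
          _ = C ^ k * (2 + fluctuation p) ^ (4 * k) := by rw [mul_pow, pow_mul]
          _ ≤ C ^ k * (12 ^ (4 * k) * (4 * k).factorial * Real.exp 1
                * Real.exp (1 / 12 * fluctuation p)) := by
              gcongr
              exact pow_two_add_le_exp (fluctuation_nonneg p) _
          _ = _ := by rw [hB]; ring
    _ = ENNReal.ofReal B * _ := lintegral_const_mul' _ _ ENNReal.ofReal_ne_top
    _ ≤ ENNReal.ofReal B * ENNReal.ofReal (6 * Real.exp 1) := by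
        gcongr
        exact lintegral_exp_fluctuation_le hn
    _ = _ := (ENNReal.ofReal_mul hB0).symm
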